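/- arXiv:math/0212318 — 2 statements merged into one kernel-verified Lean document; each statement's English description precedes it below -/
import Mathlib

section
/- Let m = (m₁,…,m_k) be positive integers summing to n and μ ∈ ℂ[t]^k, and suppose there is a permutation τ of {1,…,k} with m_{τ(i)} = m_i and −c(μ_i) = μ_{τ(i)} − m_{τ(i)}·t + n·t for all i. Then there exists a *-structure (relative to c) on the ℂ[t]-algebra A_{m,μ,t} such that ([E^i_j])* = −[E^i_j] for all 1 ≤ i,j ≤ n, where [E^i_j] denotes the class of E^i_j in A_{m,μ,t}. -/
noncomputable section

open Polynomial MulOpposite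

abbrev Ct : Type := Polynomial ℂ

abbrev FA (n : ℕ) : Type := FreeAlgebra Ct (Fin n × Fin n)

/-- The defining relations of `U(g_t)`. -/
inductive glRel (n : ℕ) : FA n → FA n → Prop
  | comm (i j l m : Fin n) :
      glRel n
        (FreeAlgebra.ι Ct ((i, j) : Fin n × Fin n) * FreeAlgebra.ι Ct ((m, l) : Fin n × Fin n)
          - FreeAlgebra.ι Ct ((m, l) : Fin n × Fin n) * FreeAlgebra.ι Ct ((i, j) : Fin n × Fin n))
        ((X : Ct) • ((if j = m then (1 : Ct) else 0) • FreeAlgebra.ι Ct ((i, l) : Fin n × Fin n)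
          - (if i = l then (1 : Ct) else 0) • FreeAlgebra.ι Ct ((m, j) : Fin n × Fin n)))

/-- `U(g_t)`. -/
abbrev Ugt (n : ℕ) : Type := RingQuot (glRel n)

/-- The generator `E^i_j`. -/
def Egen (n : ℕ) (i j : Fin n) : Ugt n :=
  RingQuot.mkAlgHom Ct (glRel n) (FreeAlgebra.ι Ct (i, j))

/-- The matrix `E` with entries in the opposite algebra (used for the "paper" product
convention). -/
def EmatOp (n : ℕ) : Matrix (Fin n) (Fin n) (Ugt n)ᵐᵒᵖ :=
  Matrix.of fun i j => op (Egen n i j)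

/-- The matrix `E`. -/
def Emat (n : ℕ) : Matrix (Fin n) (Fin n) (Ugt n) :=
  Matrix.of fun i j => Egen n i j

/-- Entries of `(E-μ₁)⋯(E-μ_k)` in the paper's convention
`(E^ℓ)^i_j = Σ E^{α₁}_j E^{α₂}_{α₁} ⋯ E^i_{α_{ℓ-1}}`. -/
def prodE (n k : ℕ) (μ : Fin k → Ct) : Matrix (Fin n) (Fin n) (Ugt n) :=
  Matrix.of fun i j =>
    unop (((List.ofFn fun s : Fin k =>
      EmatOp n - algebraMap Ct (Matrix (Fin n) (Fin n) (Ugt n)ᵐᵒᵖ) (μ s)).prod) i j)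

/-- `Tr E^ℓ` in the paper's convention. -/
def trE (n ℓ : ℕ) : Ugt n := unop (Matrix.trace (EmatOp n ^ ℓ))

/-- Entries of `(E-ν₁)∘⋯∘(E-ν_k)` in the opposite convention
`(E^{∘ℓ})^i_j = Σ E^i_{α₁} E^{α₁}_{α₂} ⋯ E^{α_{ℓ-1}}_j`. -/
def prodEop (n k : ℕ) (ν : Fin k → Ct) : Matrix (Fin n) (Fin n) (Ugt n) :=
  (List.ofFn fun s : Fin k =>
    Emat n - algebraMap Ct (Matrix (Fin n) (Fin n) (Ugt n)) (ν s)).prod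

/-- `Tr E^{∘ℓ}`. -/
def trEop (n ℓ : ℕ) : Ugt n := Matrix.trace (Emat n ^ ℓ)

/-- `θ_ℓ(m, μ, τ)`. -/
def theta {R : Type*} [CommRing R] {k : ℕ} (m : Fin k → ℕ) (μ : Fin k → R) (τ : R)
    (ℓ : ℕ) : R :=
  ∑ s ∈ Finset.Icc 1 k,
    if s ≤ ℓ + 1 then
      τ ^ (s - 1) *
        ∑ J ∈ Finset.powersetCard s (Finset.univ : Finset (Fin k)),
          (∏ j ∈ J, (m j : R)) *
            ∑ d ∈ J.finsuppAntidiag (ℓ + 1 - s), ∏ j ∈ J, μ j ^ d j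
    else 0

/-- Generators of the two-sided ideal `I_{m,μ,t}`. -/
def genSetA (n k : ℕ) (m : Fin k → ℕ) (μ : Fin k → Ct) : Set (Ugt n) :=
  {u | ∃ i j : Fin n, u = prodE n k μ i j} ∪
  {u | ∃ ℓ ∈ Finset.Icc 1 (k - 1), u = trE n ℓ - algebraMap Ct (Ugt n) (theta m μ X ℓ)}

/-- The two-sided ideal `I_{m,μ,t}`. -/
def IdealA (n k : ℕ) (m : Fin k → ℕ) (μ : Fin k → Ct) : TwoSidedIdeal (Ugt n) :=
  TwoSidedIdeal.span (genSetA n k m μ)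

/-- The algebra `A_{m,μ,t}`, the quotient of `U(g_t)` by the two-sided ideal generated by
`genSetA`. -/
abbrev AlgA (n k : ℕ) (m : Fin k → ℕ) (μ : Fin k → Ct) : Type :=
  RingQuot (fun a b : Ugt n => a - b ∈ genSetA n k m μ)

noncomputable instance instRingRingQuotUgt (n : ℕ) (r : Ugt n → Ugt n → Prop) :
    Ring (RingQuot r) :=
  RingQuot.instRing r

/-- The class of `u ∈ U(g_t)` in `A_{m,μ,t}`. -/
def clsA (n k : ℕ) (m : Fin k → ℕ) (μ : Fin k → Ct) (u : Ugt n) : AlgA n k m μ :=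
  RingQuot.mkAlgHom Ct _ u

/-- Generators of the two-sided ideal `I°_{m,ν,t}`. -/
def genSetAop (n k : ℕ) (m : Fin k → ℕ) (ν : Fin k → Ct) : Set (Ugt n) :=
  {u | ∃ i j : Fin n, u = prodEop n k ν i j} ∪
  {u | ∃ ℓ ∈ Finset.Icc 1 (k - 1), u = trEop n ℓ - algebraMap Ct (Ugt n) (theta m ν (-X) ℓ)}

/-- The two-sided ideal `I°_{m,ν,t}`. -/
def IdealAop (n k : ℕ) (m : Fin k → ℕ) (ν : Fin k → Ct) : TwoSidedIdeal (Ugt n) :=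
  TwoSidedIdeal.span (genSetAop n k m ν)

/-- The algebra `A°_{m,ν,t}`. -/
abbrev AlgAop (n k : ℕ) (m : Fin k → ℕ) (ν : Fin k → Ct) : Type :=
  RingQuot (fun a b : Ugt n => a - b ∈ genSetAop n k m ν)

/-- The block index (as a natural number) of `a : Fin n` for block sizes `m`. -/
def blk (k : ℕ) (m : Fin k → ℕ) (a : ℕ) : ℕ :=
  (Finset.univ.filter fun i : Fin k => ∑ j ∈ Finset.Iic i, m j ≤ a).card

/-- The parabolic subalgebra `p_t`: block upper-triangular matrices. -/
def pSet (n k : ℕ) (m : Fin k → ℕ) : Set (Matrix (Fin n) (Fin n) Ct) :=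
  {x | ∀ a b : Fin n, blk k m b < blk k m a → x a b = 0}

/-- Extension of `lam : Fin k → ℂ` to `ℕ`. -/
def lamExt (k : ℕ) (lam : Fin k → ℂ) (i : ℕ) : ℂ :=
  if h : i < k then lam ⟨i, h⟩ else 0

/-- The character `λ` of `p_t`, `x ↦ Σ_i λ_i tr(x_ii)`. -/
def pChar (n k : ℕ) (m : Fin k → ℕ) (lam : Fin k → ℂ) (x : Matrix (Fin n) (Fin n) Ct) : Ct :=
  ∑ a : Fin n, C (lamExt k lam (blk k m a)) * x a a

/-- The canonical linear map `g_t → U(g_t)`. -/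
def iotaU (n : ℕ) (x : Matrix (Fin n) (Fin n) Ct) : Ugt n :=
  ∑ i : Fin n, ∑ j : Fin n, x i j • Egen n i j

/-- The left ideal `L_λ` defining the generalized Verma module. -/
def VermaIdeal (n k : ℕ) (m : Fin k → ℕ) (lam : Fin k → ℂ) : Submodule (Ugt n) (Ugt n) :=
  Submodule.span (Ugt n)
    {u | ∃ x ∈ pSet n k m, u = iotaU n x - algebraMap Ct (Ugt n) (pChar n k m lam x)}

noncomputable instance instHasQuotientUgt (n : ℕ) :
    HasQuotient (Ugt n) (Submodule (Ugt n) (Ugt n)) := by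
  with_unfolding_all exact @Submodule.hasQuotient (Ugt n) (Ugt n) _ _ Semiring.toModule

noncomputable instance instAddCommGroupQuotUgt (n : ℕ) (p : Submodule (Ugt n) (Ugt n)) :
    AddCommGroup (Ugt n ⧸ p) := by
  with_unfolding_all exact @Submodule.Quotient.addCommGroup (Ugt n) (Ugt n) _ _ Semiring.toModule p

noncomputable instance instModuleQuotUgt (n : ℕ) (p : Submodule (Ugt n) (Ugt n)) :
    Module (Ugt n) (Ugt n ⧸ p) := by
  with_unfolding_all exact @Submodule.Quotient.module (Ugt n) (Ugt n) _ _ Semiring.toModule p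

/-- The generalized Verma module `V_{p_t,λ} = U(g_t)/L_λ`. -/
abbrev Verma (n k : ℕ) (m : Fin k → ℕ) (lam : Fin k → ℂ) : Type :=
  Ugt n ⧸ VermaIdeal n k m lam

/-- The annihilator `J_{p_t,λ}` of the generalized Verma module, as a set. -/
def annSet (n k : ℕ) (m : Fin k → ℕ) (lam : Fin k → ℂ) : Set (Ugt n) :=
  {u | ∀ v : Verma n k m lam, u • v = 0}

/-- The ring involution of `ℂ[t]` conjugating the coefficients and fixing `t`. -/
def cconj : Ct → Ct := fun f => f.map (starRingEnd ℂ)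

/-- A `*`-structure on a `ℂ[t]`-algebra `B` relative to `cconj`: an additive,
`cconj`-semilinear, unital, involutive anti-automorphism. -/
def IsStarStructure {B : Type*} [Ring B] [Algebra Ct B] (s : B → B) : Prop :=
  (∀ u v : B, s (u + v) = s u + s v) ∧
  (∀ (f : Ct) (u : B), s (f • u) = cconj f • s u) ∧
  (∀ u v : B, s (u * v) = s v * s u) ∧
  s 1 = 1 ∧
  ∀ u : B, s (s u) = u


section Scalar

variable {R : Type*} [CommRing R] {ι : Type*} [DecidableEq ι]

/-- The formula defining `theta`, with the index set `Fin k` replaced by a finite set `S`. -/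
def thetaOn (m : ι → ℕ) (μ : ι → R) (τ : R) (S : Finset ι) (ℓ : ℕ) : R :=
  ∑ s ∈ Finset.Icc 1 S.card,
    if s ≤ ℓ + 1 then
      τ ^ (s - 1) *
        ∑ J ∈ Finset.powersetCard s S,
          (∏ j ∈ J, (m j : R)) *
            ∑ d ∈ J.finsuppAntidiag (ℓ + 1 - s), ∏ j ∈ J, μ j ^ d j
    else 0

/-- The power series `∏ (1 + τ m_j y / (1 - μ_j y))`. -/
def thetaSeries (m : ι → ℕ) (μ : ι → R) (τ : R) (S : Finset ι) : PowerSeries R :=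
  ∏ j ∈ S, (1 + PowerSeries.C (τ * m j) * PowerSeries.X * PowerSeries.mk fun d => μ j ^ d)

theorem mul_thetaOn (m : ι → ℕ) (μ : ι → R) (τ : R) (S : Finset ι) (ℓ : ℕ) :
    τ * thetaOn m μ τ S ℓ = PowerSeries.coeff (ℓ + 1) (thetaSeries m μ τ S) := by
  have key (J : Finset ι) : PowerSeries.coeff (ℓ + 1)
      (∏ j ∈ J, (PowerSeries.C (τ * m j) * PowerSeries.X * PowerSeries.mk fun d => μ j ^ d)) =
      if J.card ≤ ℓ + 1 then τ ^ J.card * ((∏ j ∈ J, (m j : R)) *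
        ∑ d ∈ J.finsuppAntidiag (ℓ + 1 - J.card), ∏ j ∈ J, μ j ^ d j) else 0 := by
    rw [Finset.prod_mul_distrib, Finset.prod_mul_distrib, ← map_prod, mul_assoc,
      Finset.prod_const, PowerSeries.coeff_C_mul, PowerSeries.coeff_X_pow_mul']
    split_ifs
    · rw [PowerSeries.coeff_prod, Finset.prod_mul_distrib, Finset.prod_const, mul_assoc]
      simp only [PowerSeries.coeff_mk]
    · rw [mul_zero]
  rw [thetaSeries, Finset.prod_one_add, map_sum, Finset.sum_congr rfl fun J _ => key J,
    Finset.sum_powerset, Finset.range_eq_Ico, Finset.sum_eq_sum_Ico_succ_bot (by omega), thetaOn,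
    Finset.mul_sum]
  have h0 : (Finset.finsuppAntidiag (∅ : Finset ι) (ℓ + 1)) = ∅ := by
    simp
  simp only [Finset.powersetCard_zero, Finset.sum_singleton, Finset.card_empty, Nat.sub_zero, h0,
    Finset.sum_empty, mul_zero, ite_self, zero_add]
  refine Finset.sum_congr (by ext; simp) fun s hs => ?_
  rw [Finset.mem_Ico] at hs
  rw [mul_ite, mul_zero, ← mul_assoc, mul_pow_sub_one (by omega)]
  split_ifs with h
  · rw [Finset.mul_sum]
    refine Finset.sum_congr rfl fun J hJ => ?_
    rw [(Finset.mem_powersetCard.1 hJ).2, if_pos h]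
  · refine (Finset.sum_eq_zero fun J hJ => ?_).symm
    rw [(Finset.mem_powersetCard.1 hJ).2, if_neg h]

theorem thetaOn_empty (m : ι → ℕ) (μ : ι → R) (τ : R) (ℓ : ℕ) :
    thetaOn m μ τ ∅ ℓ = 0 := by
  simp [thetaOn]

theorem thetaOn_zero (m : ι → ℕ) (μ : ι → R) (τ : R) (S : Finset ι) :
    thetaOn m μ τ S 0 = ∑ j ∈ S, (m j : R) := by
  rcases S.eq_empty_or_nonempty with rfl | hS
  · simp [thetaOn]
  rw [thetaOn, Finset.sum_eq_single 1]
  · simp [Finset.powersetCard_one, Finset.sum_map]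
  · intro s hs h1
    rw [if_neg]
    rw [Finset.mem_Icc] at hs
    omega
  · intro h
    exact absurd (Finset.mem_Icc.2 ⟨le_rfl, hS.card_pos⟩) h

theorem thetaSeries_insert_mul (m : ι → ℕ) (μ : ι → R) (τ : R) {S : Finset ι} {i : ι}
    (hi : i ∉ S) :
    thetaSeries m μ τ (insert i S) * (1 - PowerSeries.C (μ i) * PowerSeries.X) =
      thetaSeries m μ τ S * (1 - PowerSeries.C (μ i - τ * m i) * PowerSeries.X) := by
  have hG : (PowerSeries.mk fun d => μ i ^ d) * (1 - PowerSeries.C (μ i) * PowerSeries.X) = 1 := by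
    ext d
    rw [mul_sub, mul_one, map_sub, ← mul_assoc, mul_comm _ (PowerSeries.C _), mul_assoc,
      PowerSeries.coeff_C_mul]
    cases d with
    | zero => simp
    | succ d =>
      rw [PowerSeries.coeff_succ_mul_X]
      simp [PowerSeries.coeff_one, pow_succ, mul_comm]
  rw [thetaSeries, Finset.prod_insert hi, thetaSeries, map_sub]
  linear_combination (∏ j ∈ S, (1 + PowerSeries.C (τ * m j) * PowerSeries.X *
    PowerSeries.mk fun d => μ j ^ d)) * (PowerSeries.C (τ * m i) * PowerSeries.X) * hG

theorem thetaOn_insert_succ [IsDomain R] (m : ι → ℕ) (μ : ι → R) {τ : R} (hτ : τ ≠ 0)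
    {S : Finset ι} {i : ι} (hi : i ∉ S) (ℓ : ℕ) :
    thetaOn m μ τ (insert i S) (ℓ + 1) - μ i * thetaOn m μ τ (insert i S) ℓ =
      thetaOn m μ τ S (ℓ + 1) - (μ i - τ * m i) * thetaOn m μ τ S ℓ := by
  have h := congrArg (PowerSeries.coeff (ℓ + 1 + 1)) (thetaSeries_insert_mul m μ τ hi)
  have e (W : PowerSeries R) (a : R) : PowerSeries.coeff (ℓ + 1 + 1)
      (W * (1 - PowerSeries.C a * PowerSeries.X)) =
      PowerSeries.coeff (ℓ + 1 + 1) W - a * PowerSeries.coeff (ℓ + 1) W := by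
    rw [mul_sub, mul_one, map_sub, mul_left_comm, PowerSeries.coeff_C_mul,
      PowerSeries.coeff_succ_mul_X]
  rw [e, e, ← mul_thetaOn, ← mul_thetaOn, ← mul_thetaOn, ← mul_thetaOn] at h
  apply mul_left_cancel₀ hτ
  linear_combination h

/-- The linear functional on polynomials sending `X ^ ℓ` to `a ℓ`. -/
def momentMap (a : ℕ → R) : R[X] →ₗ[R] R := (Polynomial.basisMonomials R).constr R a

theorem momentMap_X_pow (a : ℕ → R) (ℓ : ℕ) : momentMap a (X ^ ℓ) = a ℓ := by
  simpa [momentMap, Polynomial.monomial_one_right_eq_X_pow] using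
    (Polynomial.basisMonomials R).constr_basis R a ℓ

theorem momentMap_one (a : ℕ → R) : momentMap a 1 = a 0 := by
  rw [← momentMap_X_pow a 0, pow_zero]

theorem momentMap_C (a : ℕ → R) (r : R) : momentMap a (C r) = r * a 0 := by
  rw [← mul_one (C r), ← smul_eq_C_mul, map_smul, momentMap_one, smul_eq_mul]

theorem momentMap_insert [IsDomain R] (m : ι → ℕ) (μ : ι → R) {τ : R} (hτ : τ ≠ 0)
    {S : Finset ι} {i : ι} (hi : i ∉ S) (f : R[X]) :
    momentMap (thetaOn m μ τ (insert i S)) ((X - C (μ i)) * f) =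
      momentMap (thetaOn m μ τ S) ((X - C (μ i - τ * m i)) * f) := by
  induction f using Polynomial.induction_on' with
  | add p q hp hq => rw [mul_add, mul_add, map_add, map_add, hp, hq]
  | monomial ℓ r =>
    rw [← Polynomial.C_mul_X_pow_eq_monomial, ← smul_eq_C_mul, mul_smul_comm, mul_smul_comm,
      map_smul, map_smul, sub_mul, sub_mul, ← pow_succ', ← smul_eq_C_mul, ← smul_eq_C_mul,
      map_sub, map_sub, map_smul, map_smul]
    simp only [momentMap_X_pow, smul_eq_mul, thetaOn_insert_succ m μ hτ hi]

/-- The images of the powers of `X` under `transferMap`. -/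
def transferSeq (c t : R) (a : ℕ → R) : ℕ → R[X]
  | 0 => 1
  | ℓ + 1 => (X - C c) * transferSeq c t a ℓ + C (t * a ℓ)

/-- The linear map `T` with `T 1 = 1` and `T (X f) = (X - c) T f + t a(f)`, where `a(f)` is the
value at `f` of the functional with moments `a`. -/
def transferMap (c t : R) (a : ℕ → R) : R[X] →ₗ[R] R[X] :=
  (Polynomial.basisMonomials R).constr R (transferSeq c t a)

theorem transferMap_X_pow (c t : R) (a : ℕ → R) (ℓ : ℕ) :
    transferMap c t a (X ^ ℓ) = transferSeq c t a ℓ := by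
  simpa [transferMap, Polynomial.monomial_one_right_eq_X_pow] using
    (Polynomial.basisMonomials R).constr_basis R (transferSeq c t a) ℓ

theorem transferMap_one (c t : R) (a : ℕ → R) : transferMap c t a 1 = 1 := by
  rw [← pow_zero X, transferMap_X_pow, transferSeq, pow_zero]

theorem transferMap_X_mul (c t : R) (a : ℕ → R) (f : R[X]) :
    transferMap c t a (X * f) = (X - C c) * transferMap c t a f + C (t * momentMap a f) := by
  induction f using Polynomial.induction_on' with
  | add p q hp hq =>
    simp only [mul_add, map_add, hp, hq]
    ring
  | monomial ℓ r =>
    rw [← Polynomial.C_mul_X_pow_eq_monomial, ← smul_eq_C_mul, mul_smul_comm, ← pow_succ',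
      map_smul, map_smul, map_smul, transferMap_X_pow, transferMap_X_pow, momentMap_X_pow,
      transferSeq, smul_add, mul_smul_comm, smul_eq_mul, mul_left_comm]
    simp only [smul_eq_C_mul, C_mul]

theorem transferMap_X_sub_C_mul (c t : R) (a : ℕ → R) (b : R) (f : R[X]) :
    transferMap c t a ((X - C b) * f) =
      (X - C (b + c)) * transferMap c t a f + C (t * momentMap a f) := by
  rw [sub_mul, map_sub, transferMap_X_mul, ← smul_eq_C_mul, map_smul, smul_eq_C_mul, C_add]
  ring

theorem transferMap_insert [IsDomain R] (m : ι → ℕ) (μ : ι → R) (c : R) {t : R} (ht : t ≠ 0)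
    {S : Finset ι} {i : ι} (hi : i ∉ S) (f : R[X]) :
    transferMap c t (thetaOn m μ t (insert i S)) ((X - C (μ i)) * f) =
      transferMap c t (thetaOn m μ t S) ((X - C (μ i - t * m i)) * f) := by
  induction f using Polynomial.induction_on with
  | C a =>
    rw [mul_comm, mul_comm _ (C a), ← smul_eq_C_mul, ← smul_eq_C_mul, map_smul, map_smul,
      ← mul_one (X - _), ← mul_one (X - C (_ - _)), transferMap_X_sub_C_mul,
      transferMap_X_sub_C_mul, transferMap_one, transferMap_one, momentMap_one, momentMap_one,
      thetaOn_zero, thetaOn_zero, Finset.sum_insert hi]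
    simp only [C_add, C_sub, C_mul]
    ring_nf
  | add p q hp hq => rw [mul_add, mul_add, map_add, map_add, hp, hq]
  | monomial ℓ a h =>
    have e (b : R) : (X - C b) * (C a * X ^ (ℓ + 1)) = X * ((X - C b) * (C a * X ^ ℓ)) := by ring
    rw [e, e, transferMap_X_mul, transferMap_X_mul, h, momentMap_insert m μ ht hi]

theorem transferMap_thetaOn_prod [IsDomain R] (m : ι → ℕ) (μ : ι → R) (c : R) {t : R}
    (ht : t ≠ 0) (S : Finset ι) :
    transferMap c t (thetaOn m μ t S) (∏ i ∈ S, (X - C (μ i))) =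
      ∏ i ∈ S, (X - C (μ i - t * m i + c)) := by
  suffices H : ∀ f : R[X], transferMap c t (thetaOn m μ t S) ((∏ i ∈ S, (X - C (μ i))) * f) =
      (∏ i ∈ S, (X - C (μ i - t * m i + c))) * transferMap c t (thetaOn m μ t ∅) f by
    simpa [transferMap_one] using H 1
  induction S using Finset.induction_on with
  | empty => simp
  | insert i S hi ih =>
    intro f
    rw [Finset.prod_insert hi, Finset.prod_insert hi, mul_assoc, transferMap_insert m μ c ht hi,
      mul_left_comm, ih, transferMap_X_sub_C_mul]
    have h0 : momentMap (thetaOn m μ t ∅) f = 0 := by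
      rw [momentMap, show thetaOn m μ t ∅ = 0 from funext (thetaOn_empty m μ t), map_zero,
        LinearMap.zero_apply]
    rw [h0, mul_zero, C_0, add_zero]
    ring

theorem momentMap_transferMap [IsDomain R] (m : ι → ℕ) (μ : ι → R) (c : R) {t : R}
    (ht : t ≠ 0) (S : Finset ι) (f : R[X]) :
    momentMap (thetaOn m (fun i => μ i - t * m i + c) (-t) S)
      (transferMap c t (thetaOn m μ t S) f) = momentMap (thetaOn m μ t S) f := by
  have hzero (a : R[X]) (ν : ι → R) (s : R) : momentMap (thetaOn m ν s ∅) a = 0 := by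
    rw [momentMap, show thetaOn m ν s ∅ = 0 from funext (thetaOn_empty m ν s), map_zero,
      LinearMap.zero_apply]
  induction S using Finset.induction_on generalizing f with
  | empty => rw [hzero, hzero]
  | insert i S hi ih =>
    obtain ⟨g, r, rfl⟩ : ∃ (g : R[X]) (r : R), f = (X - C (μ i)) * g + C r :=
      ⟨f /ₘ (X - C (μ i)), f.eval (μ i), by
        rw [← modByMonic_X_sub_C_eq_C_eval, add_comm, modByMonic_add_div]⟩
    have h1 := ih ((X - C (μ i)) * g)
    have h2 := momentMap_insert m (fun i => μ i - t * m i + c) (neg_ne_zero.2 ht) hi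
      (transferMap c t (thetaOn m μ t S) g)
    rw [transferMap_X_sub_C_mul, map_add, momentMap_C, thetaOn_zero] at h1
    have h3 : transferMap c t (thetaOn m μ t (insert i S)) (C r) = C r := by
      rw [← mul_one (C r), ← smul_eq_C_mul, map_smul, transferMap_one]
    rw [map_add, map_add, map_add, transferMap_insert m μ c ht hi, h3, transferMap_X_sub_C_mul,
      map_add, momentMap_insert m μ ht hi, h2, momentMap_C, momentMap_C, momentMap_C,
      thetaOn_zero, thetaOn_zero, Finset.sum_insert hi]
    have h4 : μ i - t * m i + c - -t * m i = μ i + c := by ring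
    have h5 : momentMap (thetaOn m μ t S) ((X - C (μ i - t * m i)) * g) =
        momentMap (thetaOn m μ t S) ((X - C (μ i)) * g) +
          t * m i * momentMap (thetaOn m μ t S) g := by
      rw [← smul_eq_mul (t * _), ← map_smul, ← map_add, smul_eq_C_mul, C_sub]
      congr 1
      ring
    rw [h4, h5]
    linear_combination h1

end Scalar

section MatrixPowers

variable {R : Type*} [CommRing R] {B : Type*} [Ring B] [Algebra R B]
  {ι : Type*} [Fintype ι] [DecidableEq ι]

/-- A matrix over a ring regarded as a matrix over the opposite ring. -/
def opMatrix (e : Matrix ι ι B) : Matrix ι ι Bᵐᵒᵖ := Matrix.of fun i j => op (e i j)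

/-- The value of the polynomial `f` at the matrix `e`, with the entries multiplied in the opposite
order. -/
def rightAeval (e : Matrix ι ι B) : R[X] →ₗ[R] Matrix ι ι B where
  toFun f := Matrix.of fun i j => unop (aeval (opMatrix e) f i j)
  map_add' f g := by ext; simp
  map_smul' r f := by ext; simp

theorem rightAeval_one (e : Matrix ι ι B) : rightAeval e (1 : R[X]) = 1 := by
  ext i j
  by_cases h : i = j <;> simp [rightAeval, Matrix.one_apply, h]

theorem rightAeval_X_mul_apply (e : Matrix ι ι B) (f : R[X]) (i j : ι) :
    rightAeval e (X * f) i j = ∑ α, rightAeval e f α j * e i α := by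
  simp [rightAeval, Matrix.mul_apply, opMatrix]

/-- The commutation relations of `gl` with bracket rescaled by `t`. -/
def IsGLMatrix (t : R) (e : Matrix ι ι B) : Prop :=
  ∀ i j a b, e i j * e a b - e a b * e i j =
    t • ((if j = a then e i b else 0) - (if i = b then e a j else 0))

theorem IsGLMatrix.commutator_rightAeval {t : R} {e : Matrix ι ι B} (he : IsGLMatrix t e)
    (f : R[X]) (i j a b : ι) :
    e i j * rightAeval e f a b - rightAeval e f a b * e i j =
      t • ((if j = a then rightAeval e f i b else 0) -
        (if i = b then rightAeval e f a j else 0)) := by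
  induction f using Polynomial.induction_on generalizing a b i j with
  | C r =>
    rw [← mul_one (C r), ← smul_eq_C_mul, map_smul, rightAeval_one]
    simp only [Matrix.smul_apply, Matrix.one_apply]
    have h1 : e i j * (if a = b then 1 else 0) = (if a = b then 1 else 0) * e i j := by
      split_ifs <;> simp
    rw [mul_smul_comm, smul_mul_assoc, h1, sub_self]
    by_cases h2 : j = a <;> by_cases h3 : i = b <;> simp [h2, h3, eq_comm (a := a) (b := j)]
  | add p q hp hq =>
    rw [map_add]
    simp only [Matrix.add_apply]
    rw [mul_add, add_mul, add_sub_add_comm, hp, hq, ← smul_add]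
    congr 1
    split_ifs <;> abel
  | monomial ℓ r h =>
    have e1 : C r * X ^ (ℓ + 1) = X * (C r * X ^ ℓ) := by ring
    rw [e1]
    generalize C r * X ^ ℓ = g at h
    simp only [rightAeval_X_mul_apply]
    rw [Finset.mul_sum, Finset.sum_mul, ← Finset.sum_sub_distrib]
    have e2 (α : ι) : e i j * (rightAeval e g α b * e a α) - rightAeval e g α b * e a α * e i j =
        t • (((if j = α then rightAeval e g i b else 0) -
          (if i = b then rightAeval e g α j else 0)) * e a α +
          rightAeval e g α b * ((if j = a then e i α else 0) - (if i = α then e a j else 0))) := by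
      rw [smul_add, ← smul_mul_assoc, ← h, ← mul_smul_comm, ← he]
      noncomm_ring
    rw [Finset.sum_congr rfl fun α _ => e2 α, ← Finset.smul_sum]
    congr 1
    rw [Finset.sum_add_distrib]
    simp only [sub_mul, mul_sub, Finset.sum_sub_distrib, ite_mul, mul_ite, zero_mul, mul_zero,
      Finset.sum_ite_eq, Finset.mem_univ, if_true]
    split_ifs <;> simp <;> abel

theorem IsGLMatrix.rightAeval_X_mul {t : R} {e : Matrix ι ι B} (he : IsGLMatrix t e) (f : R[X]) :
    rightAeval e (X * f) = (e - algebraMap R _ (Fintype.card ι * t)) * rightAeval e f +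
      t • Matrix.scalar ι (rightAeval e f).trace := by
  ext i j
  rw [rightAeval_X_mul_apply, sub_mul, ← Algebra.smul_def, Matrix.add_apply, Matrix.sub_apply,
    Matrix.mul_apply, Matrix.smul_apply, Matrix.smul_apply, Matrix.scalar_apply,
    Matrix.diagonal_apply]
  have h (α : ι) : rightAeval e f α j * e i α = e i α * rightAeval e f α j -
      t • (rightAeval e f i j - if i = j then rightAeval e f α α else 0) := by
    have := he.commutator_rightAeval f i α α j
    rw [if_pos rfl] at this
    rw [← this, sub_sub_cancel]
  rw [Finset.sum_congr rfl fun α _ => h α, Finset.sum_sub_distrib, ← Finset.smul_sum,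
    Finset.sum_sub_distrib, Finset.sum_const, Finset.card_univ, smul_sub, mul_comm, mul_smul,
    Nat.cast_smul_eq_nsmul, Matrix.trace]
  split_ifs <;> simp [sub_add]

theorem scalar_algebraMap (r : R) :
    Matrix.scalar ι (algebraMap R B r) = algebraMap R (Matrix ι ι B) r := by
  ext i j
  simp [Matrix.algebraMap_matrix_apply, Matrix.diagonal_apply]

/-- Evaluation with reversed products is, up to degree `k`, ordinary evaluation after
`transferMap`, provided the traces of the first `k` powers are scalars. -/
theorem IsGLMatrix.rightAeval_eq_aeval {t : R} {e : Matrix ι ι B} (he : IsGLMatrix t e) {k : ℕ}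
    {a : ℕ → R} (ha : ∀ ℓ < k, (rightAeval e (X ^ ℓ : R[X])).trace = algebraMap R B (a ℓ))
    {f : R[X]} (hf : f.natDegree ≤ k) :
    rightAeval e f = aeval e (transferMap (Fintype.card ι * t) t a f) := by
  have hpow : ∀ ℓ ≤ k, rightAeval e (X ^ ℓ : R[X]) =
      aeval e (transferMap (Fintype.card ι * t) t a (X ^ ℓ)) := by
    intro ℓ
    induction ℓ with
    | zero => intro _; rw [pow_zero, transferMap_one, rightAeval_one, map_one]
    | succ ℓ ih =>
      intro hℓ
      rw [pow_succ', transferMap_X_mul, he.rightAeval_X_mul, ha ℓ (by omega), ih (by omega),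
        scalar_algebraMap, momentMap_X_pow, map_add, map_mul (aeval e), map_sub, aeval_X, aeval_C,
        aeval_C, map_mul (algebraMap R (Matrix ι ι B)) t, ← Algebra.smul_def t]
  rw [f.as_sum_range_C_mul_X_pow, map_sum, map_sum, map_sum]
  refine Finset.sum_congr rfl fun ℓ hℓ => ?_
  rw [Finset.mem_range] at hℓ
  rw [← smul_eq_C_mul, map_smul, map_smul, map_smul, hpow ℓ (by omega)]

theorem transferSeq_monic (c t : R) (a : ℕ → R) (ℓ : ℕ) [Nontrivial R] :
    (transferSeq c t a ℓ).Monic ∧ (transferSeq c t a ℓ).natDegree = ℓ := by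
  induction ℓ with
  | zero => exact ⟨monic_one, natDegree_one⟩
  | succ ℓ ih =>
    have hm : ((X - C c) * transferSeq c t a ℓ).Monic := (monic_X_sub_C c).mul ih.1
    have hd : ((X - C c) * transferSeq c t a ℓ).natDegree = ℓ + 1 := by
      rw [(monic_X_sub_C c).natDegree_mul ih.1, natDegree_X_sub_C, ih.2, add_comm]
    have hlt : (C (t * a ℓ)).degree < ((X - C c) * transferSeq c t a ℓ).degree := by
      refine degree_C_le.trans_lt ?_
      rw [← natDegree_pos_iff_degree_pos, hd]
      exact ℓ.succ_pos
    refine ⟨hm.add_of_left hlt, ?_⟩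
    rw [transferSeq, natDegree_add_eq_left_of_degree_lt hlt, hd]

theorem IsGLMatrix.trace_pow [Nontrivial R] {t : R} {e : Matrix ι ι B} (he : IsGLMatrix t e)
    {k : ℕ} {a b : ℕ → R}
    (ha : ∀ ℓ < k, (rightAeval e (X ^ ℓ : R[X])).trace = algebraMap R B (a ℓ))
    (hab : ∀ f, momentMap b (transferMap (Fintype.card ι * t) t a f) = momentMap a f)
    {ℓ : ℕ} (hℓ : ℓ < k) : (e ^ ℓ).trace = algebraMap R B (b ℓ) := by
  induction ℓ using Nat.strong_induction_on with
  | _ ℓ ih =>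
    set T := transferMap (Fintype.card ι * t) t a (X ^ ℓ) with hT
    obtain ⟨hmon, hdeg⟩ := transferSeq_monic (Fintype.card ι * t) t a ℓ
    rw [← transferMap_X_pow, ← hT] at hmon hdeg
    have h1 : (aeval e T).trace = algebraMap R B (momentMap b T) := by
      rw [hT, hab, ← he.rightAeval_eq_aeval ha ((natDegree_X_pow_le ℓ).trans hℓ.le), ha ℓ hℓ,
        momentMap_X_pow]
    have hlow (f : R[X]) (hf : ∀ i, ℓ ≤ i → f.coeff i = 0) :
        (aeval e f).trace = algebraMap R B (momentMap b f) := by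
      rw [f.as_sum_range' (f.natDegree + 1) (Nat.lt_succ_self _), map_sum, Matrix.trace_sum,
        map_sum, map_sum]
      refine Finset.sum_congr rfl fun i _ => ?_
      rw [← C_mul_X_pow_eq_monomial, ← smul_eq_C_mul, map_smul, map_smul, Matrix.trace_smul]
      rcases lt_or_ge i ℓ with hi | hi
      · rw [map_pow, aeval_X, ih i hi (hi.trans hℓ), momentMap_X_pow, smul_eq_mul, map_mul,
          Algebra.smul_def]
      · rw [hf i hi, zero_smul, zero_smul, map_zero]
    have h2 := hlow (T - X ^ ℓ) fun i hi => by
      rw [coeff_sub, coeff_X_pow]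
      rcases hi.eq_or_lt with rfl | hi
      · have := hmon.coeff_natDegree
        rw [hdeg] at this
        rw [this, if_pos rfl, sub_self]
      · rw [coeff_eq_zero_of_natDegree_lt (hdeg.trans_lt hi), if_neg hi.ne', sub_self]
    rw [map_sub, map_sub, map_sub, Matrix.trace_sub, h1, map_pow, aeval_X, momentMap_X_pow] at h2
    exact sub_right_injective h2

end MatrixPowers

section Symmetry

variable {R : Type*} [CommRing R] {ι : Type*} [DecidableEq ι]

theorem thetaOn_neg [IsDomain R] (m : ι → ℕ) (μ : ι → R) {τ : R} (hτ : τ ≠ 0) (S : Finset ι)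
    (ℓ : ℕ) : thetaOn m (-μ) τ S ℓ = (-1) ^ ℓ * thetaOn m μ (-τ) S ℓ := by
  have h : thetaSeries m (-μ) τ S = PowerSeries.rescale (-1) (thetaSeries m μ (-τ) S) := by
    rw [thetaSeries, thetaSeries, map_prod]
    refine Finset.prod_congr rfl fun j _ => ?_
    rw [map_add, map_one, mul_assoc, mul_assoc]
    congr 1
    ext d
    rw [PowerSeries.coeff_rescale, PowerSeries.coeff_C_mul, PowerSeries.coeff_C_mul]
    cases d with
    | zero => simp
    | succ d =>
      rw [PowerSeries.coeff_succ_X_mul, PowerSeries.coeff_succ_X_mul, PowerSeries.coeff_mk,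
        PowerSeries.coeff_mk, Pi.neg_apply, neg_pow (μ j)]
      ring
  apply mul_left_cancel₀ hτ
  rw [mul_thetaOn, h, PowerSeries.coeff_rescale, ← mul_thetaOn]
  ring

theorem thetaOn_comp_equiv [IsDomain R] [Fintype ι] (m : ι → ℕ) (μ : ι → R) {τ : R}
    (hτ : τ ≠ 0) (σ : Equiv.Perm ι) (ℓ : ℕ) :
    thetaOn (m ∘ σ) (μ ∘ σ) τ Finset.univ ℓ = thetaOn m μ τ Finset.univ ℓ := by
  apply mul_left_cancel₀ hτ
  rw [mul_thetaOn, mul_thetaOn, thetaSeries, thetaSeries]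
  congr 1
  exact Equiv.prod_comp σ fun j =>
    1 + PowerSeries.C (τ * m j) * PowerSeries.X * PowerSeries.mk fun d => μ j ^ d

theorem map_thetaOn {R' : Type*} [CommRing R'] (φ : R →+* R') (m : ι → ℕ) (μ : ι → R) (τ : R)
    (S : Finset ι) (ℓ : ℕ) :
    φ (thetaOn m μ τ S ℓ) = thetaOn m (φ ∘ μ) (φ τ) S ℓ := by
  simp only [thetaOn, map_sum, apply_ite φ, map_mul, map_pow, map_prod, map_natCast, map_zero,
    Function.comp_apply]

theorem theta_eq_thetaOn {k : ℕ} (m : Fin k → ℕ) (μ : Fin k → R) (τ : R) (ℓ : ℕ) :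
    theta m μ τ ℓ = thetaOn m μ τ Finset.univ ℓ := by
  rw [thetaOn, Finset.card_univ, Fintype.card_fin, theta]

end Symmetry

section Functoriality

variable {R : Type*} [CommRing R] {B B' : Type*} [Ring B] [Algebra R B] [Ring B'] [Algebra R B']
  {ι : Type*} [Fintype ι] [DecidableEq ι]

theorem map_rightAeval (q : B →ₐ[R] B') (e : Matrix ι ι B) (f : R[X]) (i j : ι) :
    q (rightAeval e f i j) = rightAeval (e.map q) f i j := by
  induction f using Polynomial.induction_on generalizing i j with
  | C r =>
    rw [← mul_one (C r), ← smul_eq_C_mul, map_smul, map_smul, rightAeval_one, rightAeval_one,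
      Matrix.smul_apply, Matrix.smul_apply, map_smul, Matrix.one_apply, Matrix.one_apply]
    split_ifs <;> simp
  | add p p' hp hp' =>
    rw [map_add, map_add, Matrix.add_apply, Matrix.add_apply, map_add, hp, hp']
  | monomial ℓ r h =>
    have e1 : C r * X ^ (ℓ + 1) = X * (C r * X ^ ℓ) := by ring
    rw [e1, rightAeval_X_mul_apply, rightAeval_X_mul_apply, map_sum]
    exact Finset.sum_congr rfl fun α _ => by rw [map_mul, h, Matrix.map_apply]

theorem unop_map_rightAeval (φ : R →+* R) (ψ : B →+* B'ᵐᵒᵖ)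
    (hψ : ∀ r, ψ (algebraMap R B r) = op (algebraMap R B' (φ r))) (e : Matrix ι ι B)
    (e' : Matrix ι ι B') (he : ∀ i j, ψ (e i j) = op (e' i j)) (f : R[X]) (i j : ι) :
    ψ (rightAeval e f i j) = op (aeval e' (f.map φ) i j) := by
  induction f using Polynomial.induction_on generalizing i j with
  | C r =>
    rw [← mul_one (C r), ← smul_eq_C_mul, map_smul, rightAeval_one, Polynomial.map_smul,
      Polynomial.map_one, map_smul, map_one, Matrix.smul_apply, Matrix.smul_apply,
      Algebra.smul_def, Algebra.smul_def, map_mul, hψ, Matrix.one_apply, Matrix.one_apply]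
    split_ifs <;> simp
  | add p p' hp hp' =>
    rw [map_add, Matrix.add_apply, map_add, hp, hp', Polynomial.map_add, map_add,
      Matrix.add_apply, op_add]
  | monomial ℓ r h =>
    have e1 : C r * X ^ (ℓ + 1) = X * (C r * X ^ ℓ) := by ring
    rw [e1, rightAeval_X_mul_apply, map_sum, Polynomial.map_mul, map_X, map_mul (aeval e'), aeval_X,
      Matrix.mul_apply, Finset.op_sum]
    exact Finset.sum_congr rfl fun α _ => by rw [map_mul, h, he, op_mul]

end Functoriality

section QuantumOrbit

theorem trE_eq (n ℓ : ℕ) : trE n ℓ = (rightAeval (Emat n) (X ^ ℓ : Ct[X])).trace := by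
  have h : opMatrix (Emat n) = EmatOp n := rfl
  simp [trE, rightAeval, Matrix.trace, h]

theorem prodE_eq (n k : ℕ) (μ : Fin k → Ct) :
    prodE n k μ = rightAeval (Emat n) (∏ s, (X - C (μ s)) : Ct[X]) := by
  have h : opMatrix (Emat n) = EmatOp n := rfl
  ext i j
  simp only [prodE, rightAeval, h, LinearMap.coe_mk, AddHom.coe_mk, Matrix.of_apply]
  have hf : (fun s => EmatOp n - algebraMap Ct (Matrix (Fin n) (Fin n) (Ugt n)ᵐᵒᵖ) (μ s)) =
      (aeval (EmatOp n)) ∘ fun s => (X - C (μ s) : Ct[X]) := by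
    funext s
    rw [Function.comp_apply, map_sub, aeval_X, aeval_C]
  rw [← List.prod_ofFn, map_list_prod, List.map_ofFn, hf]

/-- Universal property of `U(g_t)` for ring homomorphisms with prescribed central scalars. -/
theorem exists_ringHom_Ugt {n : ℕ} {B : Type*} [Ring B] (φ : Ct →+* B)
    (hφ : ∀ f b, φ f * b = b * φ f) (e : Fin n → Fin n → B)
    (he : ∀ i j a b, e i j * e a b - e a b * e i j =
      φ X * ((if j = a then e i b else 0) - (if i = b then e a j else 0))) :
    ∃ ψ : Ugt n →+* B, (∀ f, ψ (algebraMap Ct (Ugt n) f) = φ f) ∧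
      ∀ i j, ψ (Egen n i j) = e i j := by
  let _ : Algebra Ct B := φ.toAlgebra' hφ
  have hrel : ∀ ⦃x y : FA n⦄, glRel n x y →
      FreeAlgebra.lift Ct (fun p : Fin n × Fin n => e p.1 p.2) x =
        FreeAlgebra.lift Ct (fun p : Fin n × Fin n => e p.1 p.2) y := by
    rintro _ _ ⟨i, j, l, a⟩
    simp only [map_sub, map_mul, map_smul, FreeAlgebra.lift_ι_apply]
    rw [he, Algebra.smul_def]
    simp only [ite_smul, one_smul, zero_smul]
    rfl
  refine ⟨(RingQuot.liftAlgHom Ct ⟨_, hrel⟩ : Ugt n →ₐ[Ct] B), fun f => ?_, fun i j => ?_⟩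
  · exact AlgHom.commutes _ f
  · have := RingQuot.liftAlgHom_mkAlgHom_apply Ct _ hrel (FreeAlgebra.ι Ct (i, j))
    rw [FreeAlgebra.lift_ι_apply] at this
    exact this

theorem exists_ringHom_AlgA {n k : ℕ} {m : Fin k → ℕ} {μ : Fin k → Ct} {B : Type*} [Ring B]
    (ψ : Ugt n →+* B) (hψ : ∀ u ∈ genSetA n k m μ, ψ u = 0) :
    ∃ Ψ : AlgA n k m μ →+* B, ∀ u, Ψ (clsA n k m μ u) = ψ u := by
  have hrel : ∀ ⦃x y : Ugt n⦄, x - y ∈ genSetA n k m μ → ψ x = ψ y := fun x y h =>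
    sub_eq_zero.1 (by rw [← map_sub, hψ _ h])
  refine ⟨RingQuot.lift ⟨ψ, hrel⟩, fun u => ?_⟩
  have := RingQuot.lift_mkRingHom_apply ψ hrel u
  rw [← RingQuot.mkAlgHom_coe Ct] at this
  exact this

variable {n k : ℕ} {m : Fin k → ℕ} {μ : Fin k → Ct} {B : Type*} [Ring B] [Algebra Ct B]

theorem isGLMatrix_map (q : Ugt n →ₐ[Ct] B) : IsGLMatrix (X : Ct) ((Emat n).map q) := by
  intro i j a b
  have h := congrArg q (RingQuot.mkAlgHom_rel Ct (glRel.comm i j b a))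
  have hE (i j : Fin n) : RingQuot.mkAlgHom Ct (glRel n) (FreeAlgebra.ι Ct (i, j)) = Emat n i j :=
    rfl
  simp only [map_sub, map_mul, map_smul, hE, ite_smul, one_smul, zero_smul] at h
  simp only [Matrix.map_apply]
  rw [h]
  congr 2
  · split_ifs
    · rw [hE]
    · rw [map_zero, map_zero]
  · split_ifs
    · rw [hE]
    · rw [map_zero, map_zero]

theorem map_rightAeval_Emat (q : Ugt n →ₐ[Ct] B) (f : Ct[X]) (i j : Fin n) :
    q (rightAeval (Emat n) f i j) = rightAeval ((Emat n).map q) f i j :=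
  map_rightAeval q (Emat n) f i j

theorem trace_rightAeval_map {q : Ugt n →ₐ[Ct] B} (hq : ∀ u ∈ genSetA n k m μ, q u = 0)
    (hsum : ∑ i, m i = n) {ℓ : ℕ} (hℓ : ℓ < k) :
    (rightAeval ((Emat n).map q) (X ^ ℓ : Ct[X])).trace =
      algebraMap Ct _ (thetaOn m μ X Finset.univ ℓ) := by
  rcases Nat.eq_zero_or_pos ℓ with rfl | hpos
  · rw [pow_zero, rightAeval_one, Matrix.trace_one, thetaOn_zero, Fintype.card_fin, ← Nat.cast_sum,
      hsum, map_natCast]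
  · have h := (map_sub q (trE n ℓ) (algebraMap Ct (Ugt n) (theta m μ X ℓ))).symm.trans (hq _
       (Or.inr ⟨ℓ, Finset.mem_Icc.2 ⟨hpos, by omega⟩, rfl⟩))
    rw [sub_eq_zero, AlgHom.commutes, theta_eq_thetaOn, trE_eq, Matrix.trace, map_sum] at h
    rw [← h, Matrix.trace]
    exact Finset.sum_congr rfl fun i _ => (map_rightAeval_Emat q _ i i).symm

theorem aeval_map_eq_zero {q : Ugt n →ₐ[Ct] B} (hq : ∀ u ∈ genSetA n k m μ, q u = 0)
    (hsum : ∑ i, m i = n) :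
    aeval ((Emat n).map q) (∏ i, (X - C (μ i - (X : Ct) * (m i : Ct) + (n : Ct) * X)) : Ct[X]) =
      0 := by
  have hdeg : (∏ i, (X - C (μ i)) : Ct[X]).natDegree ≤ k := by
    rw [natDegree_prod_of_monic _ _ fun i _ => monic_X_sub_C _]
    simp
  have h := (isGLMatrix_map q).rightAeval_eq_aeval
    (fun ℓ hℓ => trace_rightAeval_map hq hsum hℓ) hdeg
  rw [Fintype.card_fin, transferMap_thetaOn_prod m μ _ X_ne_zero] at h
  rw [← h]
  refine Matrix.ext fun i j => (map_rightAeval_Emat q _ i j).symm.trans ?_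
  rw [← prodE_eq, hq _ (Or.inl ⟨i, j, rfl⟩), Matrix.zero_apply]

theorem trace_map_pow {q : Ugt n →ₐ[Ct] B} (hq : ∀ u ∈ genSetA n k m μ, q u = 0)
    (hsum : ∑ i, m i = n) {ℓ : ℕ} (hℓ : ℓ < k) :
    (((Emat n).map q) ^ ℓ).trace = algebraMap Ct _
      (thetaOn m (fun i => μ i - (X : Ct) * (m i : Ct) + (n : Ct) * X) (-X) Finset.univ ℓ) :=
  (isGLMatrix_map q).trace_pow (fun ℓ hℓ => trace_rightAeval_map hq hsum hℓ)
    (fun f => by rw [Fintype.card_fin, momentMap_transferMap m μ _ X_ne_zero]) hℓ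

/-- `cconj` as a ring homomorphism. -/
def cconjHom : Ct →+* Ct := Polynomial.mapRingHom (starRingEnd ℂ)

theorem cconjHom_apply (f : Ct) : cconjHom f = cconj f := rfl

theorem cconjHom_cconjHom (f : Ct) : cconjHom (cconjHom f) = f := by
  ext i
  simp [cconjHom]

theorem aeval_neg_map_eq_zero {q : Ugt n →ₐ[Ct] B}
    (hq : ∀ u ∈ genSetA n k m μ, q u = 0) (hsum : ∑ i, m i = n) (τ : Equiv.Perm (Fin k))
    (hτμ : ∀ i, -cconj (μ i) = μ (τ i) - (m (τ i) : Ct) * X + (n : Ct) * X) :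
    aeval (-(Emat n).map q)
      ((∏ s, (X - C (μ s)) : Ct[X]).map cconjHom) = 0 := by
  have h1 : (∏ s, (X - C (μ s)) : Ct[X]).map cconjHom =
      (C ((-1) ^ k) * ∏ i, (X - C (μ i - (X : Ct) * (m i : Ct) + (n : Ct) * X))).comp (-X) := by
    rw [mul_comp, prod_comp, C_comp, ← Equiv.prod_comp τ fun i => Polynomial.comp _ (-X),
      Polynomial.map_prod, C_pow]
    have h2 : (C (-1) : Ct[X]) ^ k = ∏ _i : Fin k, C (-1) := by simp
    rw [h2, ← Finset.prod_mul_distrib]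
    refine Finset.prod_congr rfl fun i _ => ?_
    rw [Polynomial.map_sub, map_X, map_C, cconjHom_apply, ← neg_neg (cconj (μ i)), hτμ, sub_comp,
      X_comp, C_comp, mul_comm X, C_neg, C_neg, C_1]
    ring
  rw [h1, aeval_comp, map_neg, aeval_X, neg_neg, map_mul, aeval_map_eq_zero hq hsum, mul_zero]

theorem trace_neg_map_pow {q : Ugt n →ₐ[Ct] B}
    (hq : ∀ u ∈ genSetA n k m μ, q u = 0) (hsum : ∑ i, m i = n) (τ : Equiv.Perm (Fin k))
    (hτm : ∀ i, m (τ i) = m i)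
    (hτμ : ∀ i, -cconj (μ i) = μ (τ i) - (m (τ i) : Ct) * X + (n : Ct) * X)
    {ℓ : ℕ} (hℓ : ℓ < k) :
    ((-(Emat n).map q) ^ ℓ).trace =
      algebraMap Ct _ (cconjHom (theta m μ X ℓ)) := by
  have hX : cconjHom (X : Ct) = X := by simp [cconjHom]
  set ν : Fin k → Ct := fun i => μ i - (X : Ct) * (m i : Ct) + (n : Ct) * X with hν
  have h1 : (cconjHom ∘ μ : Fin k → Ct) = (-ν) ∘ τ := by
    funext i
    rw [Function.comp_apply, cconjHom_apply, ← neg_neg (cconj (μ i)), hτμ, Function.comp_apply,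
      Pi.neg_apply, hν]
    ring
  have h2 : m = m ∘ τ := funext fun i => (hτm i).symm
  have h3 : thetaOn m ((-ν) ∘ τ) X Finset.univ ℓ = thetaOn m (-ν) X Finset.univ ℓ := by
    conv_lhs => rw [h2]
    exact thetaOn_comp_equiv m (-ν) X_ne_zero τ ℓ
  have h4 : (-(Emat n).map q) ^ ℓ = ((-1) ^ ℓ : Ct) • (Emat n).map q ^ ℓ := by
    rw [← _root_.smul_pow, neg_one_smul]
  rw [theta_eq_thetaOn, map_thetaOn, hX, h1, h3, thetaOn_neg m ν X_ne_zero, h4,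
    Matrix.trace_smul, trace_map_pow hq hsum hℓ, Algebra.smul_def, map_mul]

theorem exists_ringHom_op_of_genSetA {q : Ugt n →ₐ[Ct] B} (hq : ∀ u ∈ genSetA n k m μ, q u = 0)
    (hsum : ∑ i, m i = n) (τ : Equiv.Perm (Fin k)) (hτm : ∀ i, m (τ i) = m i)
    (hτμ : ∀ i, -cconj (μ i) = μ (τ i) - (m (τ i) : Ct) * X + (n : Ct) * X) :
    ∃ ψ : Ugt n →+* Bᵐᵒᵖ, (∀ f, ψ (algebraMap Ct _ f) = op (algebraMap Ct B (cconjHom f))) ∧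
      (∀ i j, ψ (Egen n i j) = op (-q (Egen n i j))) ∧ ∀ u ∈ genSetA n k m μ, ψ u = 0 := by
  have hX : cconjHom (X : Ct) = X := by simp [cconjHom]
  obtain ⟨ψ, hψ, hψE⟩ := exists_ringHom_Ugt (n := n) (B := Bᵐᵒᵖ)
    ((algebraMap Ct Bᵐᵒᵖ).comp cconjHom) (fun f b => Algebra.commutes (cconjHom f) b)
    (fun i j => op (-(Emat n).map q i j)) fun i j a b => by
      have h := isGLMatrix_map q i j a b
      rw [RingHom.comp_apply, hX, ← Algebra.smul_def, ← op_mul, ← op_mul, ← op_sub, neg_mul_neg,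
        neg_mul_neg, ← neg_sub, h]
      split_ifs <;> simp [← op_smul, ← op_neg, ← smul_neg, sub_eq_add_neg, add_comm]
  have hψr (f : Ct) : ψ (algebraMap Ct _ f) = op (algebraMap Ct B (cconjHom f)) := hψ f
  have haeval := unop_map_rightAeval cconjHom ψ hψr (Emat n) (-(Emat n).map q) hψE
  refine ⟨ψ, hψr, hψE, ?_⟩
  rintro _ (⟨i, j, rfl⟩ | ⟨ℓ, hℓ, rfl⟩)
  · rw [prodE_eq, haeval, aeval_neg_map_eq_zero hq hsum τ hτμ, Matrix.zero_apply, op_zero]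
  · rw [Finset.mem_Icc] at hℓ
    refine (map_sub ψ _ _).trans (sub_eq_zero.2 ?_)
    rw [hψr, trE_eq, Matrix.trace, map_sum,
      ← trace_neg_map_pow hq hsum τ hτm hτμ (by omega), Matrix.trace, Finset.op_sum]
    refine Finset.sum_congr rfl fun i _ => ?_
    rw [Matrix.diag_apply, haeval, Polynomial.map_pow, map_X, map_pow, aeval_X, Matrix.diag_apply]

theorem mkAlgHom_eq_zero {u : Ugt n} (hu : u ∈ genSetA n k m μ) :
    (RingQuot.mkAlgHom Ct _ : Ugt n →ₐ[Ct] AlgA n k m μ) u = 0 := by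
  have e : u - 0 = u := sub_zero u
  have h := RingQuot.mkAlgHom_rel Ct (s := fun a b : Ugt n => a - b ∈ genSetA n k m μ)
    (show u - 0 ∈ genSetA n k m μ by rwa [e])
  exact h.trans (map_zero _)

theorem algA_induction {P : AlgA n k m μ → Prop}
    (hgen : ∀ i j, P (clsA n k m μ (Egen n i j))) (hscalar : ∀ f : Ct, P (algebraMap Ct _ f))
    (hadd : ∀ u v, P u → P v → P (u + v)) (hmul : ∀ u v, P u → P v → P (u * v))
    (u : AlgA n k m μ) : P u := by
  obtain ⟨u, rfl⟩ := RingQuot.mkAlgHom_surjective Ct (fun a b : Ugt n => a - b ∈ genSetA n k m μ) u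
  obtain ⟨u, rfl⟩ := RingQuot.mkAlgHom_surjective Ct (glRel n) u
  induction u using FreeAlgebra.induction with
  | grade0 r => rw [AlgHom.commutes, AlgHom.commutes]; exact hscalar r
  | grade1 p => exact hgen p.1 p.2
  | mul a b ha hb => rw [map_mul, map_mul]; exact hmul _ _ ha hb
  | add a b ha hb => rw [map_add, map_add]; exact hadd _ _ ha hb

end QuantumOrbit

/-- the `gl(n,ℝ)`-compatible real form of the quantum orbit. -/
theorem statement12 (n k : ℕ) (hn : 1 ≤ n) (hk : 1 ≤ k) (hkn : k ≤ n)
    (m : Fin k → ℕ) (hm : ∀ i, 0 < m i) (hsum : ∑ i, m i = n)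
    (μ : Fin k → Ct) (τ : Equiv.Perm (Fin k))
    (hτm : ∀ i, m (τ i) = m i)
    (hτμ : ∀ i, -cconj (μ i) = μ (τ i) - (m (τ i) : Ct) * X + (n : Ct) * X) :
    ∃ st : AlgA n k m μ → AlgA n k m μ, IsStarStructure st ∧
      ∀ i j : Fin n,
        st (clsA n k m μ (Egen n i j)) = -clsA n k m μ (Egen n i j) := by
  obtain ⟨ψ, hψ, hψE, hψ0⟩ := exists_ringHom_op_of_genSetA
    (q := (RingQuot.mkAlgHom Ct _ : Ugt n →ₐ[Ct] AlgA n k m μ))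
    (fun u hu => mkAlgHom_eq_zero hu) hsum τ hτm hτμ
  obtain ⟨Ψ, hΨ⟩ := exists_ringHom_AlgA ψ hψ0
  have hΨr (f : Ct) : Ψ (algebraMap Ct _ f) = op (algebraMap Ct _ (cconjHom f)) := by
    rw [← hψ, ← hΨ, clsA, AlgHom.commutes]
  have hΨE (i j : Fin n) : Ψ (clsA n k m μ (Egen n i j)) = op (-clsA n k m μ (Egen n i j)) := by
    rw [hΨ, hψE]
    rfl
  refine ⟨fun u => unop (Ψ u), ⟨fun u v => ?_, fun f u => ?_, fun u v => ?_, ?_, fun u => ?_⟩,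
    fun i j => ?_⟩
  · simp only [map_add, unop_add]
  · simp only [Algebra.smul_def, map_mul, unop_mul, hΨr, unop_op, cconjHom_apply]
    exact (Algebra.commutes _ _).symm
  · simp only [map_mul, unop_mul]
  · simp only [map_one, unop_one]
  · induction u using algA_induction with
    | hgen i j => simp only [hΨE, unop_op, map_neg, unop_neg, neg_neg]
    | hscalar f => simp only [hΨr, unop_op, cconjHom_cconjHom]
    | hadd u v hu hv => simp only [map_add, unop_add] at hu hv ⊢; rw [hu, hv]
    | hmul u v hu hv => simp only [map_mul, unop_mul] at hu hv ⊢; rw [hu, hv]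
  · simp only [hΨE, unop_op]

end
end

section
/- Let m = (m₁,…,m_k) be positive integers summing to n, μ ∈ ℂ^k, and b ∈ ℂ. Then the assignment E^i_j ↦ E^i_j − b·δ^i_j·1 extends to an isomorphism of ℂ[t]-algebras A_{m,μ,t} → A_{m,μ+b·(1,…,1),t}, where δ^i_j is the Kronecker symbol. -/
noncomputable section

open Polynomial MulOpposite

/-- The divided difference of `x ^ ℓ` at the points `μ j`, `j ∈ J`. -/
def powDividedDiff {R ι : Type*} [CommRing R] (μ : ι → R) (J : Finset ι) (ℓ : ℕ) : R :=
  PowerSeries.coeff (ℓ + 1) (∏ j ∈ J, (PowerSeries.X * PowerSeries.mk fun d => μ j ^ d))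

theorem powDividedDiff_eq {R ι : Type*} [CommRing R] [DecidableEq ι] (μ : ι → R) (J : Finset ι)
    (ℓ : ℕ) :
    powDividedDiff μ J ℓ =
      if J.card ≤ ℓ + 1 then ∑ d ∈ J.finsuppAntidiag (ℓ + 1 - J.card), ∏ j ∈ J, μ j ^ d j
      else 0 := by
  rw [powDividedDiff, Finset.prod_mul_distrib, Finset.prod_const, PowerSeries.coeff_X_pow_mul']
  simp only [PowerSeries.coeff_prod, PowerSeries.coeff_mk]

theorem powDividedDiff_insert_succ {R ι : Type*} [CommRing R] [DecidableEq ι] (μ : ι → R)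
    {J : Finset ι} {a : ι} (ha : a ∉ J) (ℓ : ℕ) :
    powDividedDiff μ (insert a J) (ℓ + 1) =
      μ a * powDividedDiff μ (insert a J) ℓ + powDividedDiff μ J ℓ := by
  have hg : (PowerSeries.mk fun d => μ a ^ d) =
      1 + PowerSeries.C (μ a) * (PowerSeries.X * PowerSeries.mk fun d => μ a ^ d) := by
    ext d
    cases d with
    | zero => simp
    | succ d =>
      simp [PowerSeries.coeff_succ_X_mul, PowerSeries.coeff_one, pow_succ, mul_comm]
  simp only [powDividedDiff, Finset.prod_insert ha]
  conv_lhs => rw [hg]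
  rw [show ∀ P Q : PowerSeries R, PowerSeries.X * (1 + PowerSeries.C (μ a) * P) * Q =
    PowerSeries.X * (PowerSeries.C (μ a) * (P * Q) + Q) by intros; ring,
    PowerSeries.coeff_succ_X_mul, map_add, PowerSeries.coeff_C_mul]

theorem powDividedDiff_insert_zero {R ι : Type*} [CommRing R] [DecidableEq ι] (μ ν : ι → R)
    {J : Finset ι} {a : ι} (ha : a ∉ J) :
    powDividedDiff μ (insert a J) 0 = powDividedDiff ν (insert a J) 0 := by
  simp [powDividedDiff, Finset.prod_insert ha, mul_assoc, PowerSeries.coeff_succ_X_mul, map_prod]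

/-- The divided difference at the points `μ j`, `j ∈ J`, as a linear functional on polynomials. -/
def dividedDiff {R ι : Type*} [CommRing R] (μ : ι → R) (J : Finset ι) : R[X] →ₗ[R] R :=
  (Polynomial.basisMonomials R).constr R (powDividedDiff μ J)

theorem dividedDiff_X_pow {R ι : Type*} [CommRing R] (μ : ι → R) (J : Finset ι) (ℓ : ℕ) :
    dividedDiff μ J (X ^ ℓ) = powDividedDiff μ J ℓ := by
  rw [dividedDiff, ← Polynomial.monomial_one_right_eq_X_pow]
  exact (Polynomial.basisMonomials R).constr_basis R _ ℓ

theorem dividedDiff_empty {R ι : Type*} [CommRing R] (μ : ι → R) :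
    dividedDiff μ (∅ : Finset ι) = 0 := by
  refine (Polynomial.basisMonomials R).ext fun ℓ => ?_
  rw [dividedDiff, Module.Basis.constr_basis]
  simp [powDividedDiff, PowerSeries.coeff_one]

theorem dividedDiff_insert_mul {R ι : Type*} [CommRing R] [DecidableEq ι] (μ : ι → R)
    {J : Finset ι} {a : ι} (ha : a ∉ J) (p : R[X]) :
    dividedDiff μ (insert a J) ((X - C (μ a)) * p) = dividedDiff μ J p := by
  induction p using Polynomial.induction_on' with
  | add p q hp hq => rw [mul_add, map_add, hp, hq, map_add]
  | monomial ℓ c =>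
    rw [← Polynomial.C_mul_X_pow_eq_monomial, ← Polynomial.smul_eq_C_mul, mul_smul_comm, map_smul,
      map_smul, sub_mul, ← pow_succ', ← Polynomial.smul_eq_C_mul,
      map_sub, map_smul]
    simp only [dividedDiff_X_pow, powDividedDiff_insert_succ μ ha, smul_eq_mul,
      add_sub_cancel_left]

theorem dividedDiff_shift {R ι : Type*} [CommRing R] (μ ν : ι → R) (b : R)
    (h : ∀ i, ν i = μ i + b) (J : Finset ι) (ℓ : ℕ) :
    dividedDiff ν J ((X - C b) ^ ℓ) = dividedDiff μ J (X ^ ℓ) := by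
  classical
  induction J using Finset.induction_on generalizing ℓ with
  | empty => simp [dividedDiff_empty]
  | insert a J ha ihJ =>
    induction ℓ with
    | zero =>
      simpa only [dividedDiff_X_pow, pow_zero] using
        (dividedDiff_X_pow ν (insert a J) 0).trans
          (powDividedDiff_insert_zero ν μ ha) |>.trans (dividedDiff_X_pow μ (insert a J) 0).symm
    | succ ℓ ih =>
      have hν : (X - C b) ^ (ℓ + 1) =
          (X - C (ν a)) * (X - C b) ^ ℓ + μ a • (X - C b) ^ ℓ := by
        rw [h a, Polynomial.smul_eq_C_mul, C_add]
        ring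
      have hμ : (X : R[X]) ^ (ℓ + 1) = (X - C (μ a)) * X ^ ℓ + μ a • X ^ ℓ := by
        rw [Polynomial.smul_eq_C_mul]
        ring
      rw [hν, hμ, map_add, map_add, dividedDiff_insert_mul ν ha, dividedDiff_insert_mul μ ha,
        map_smul, map_smul, ih, ihJ]

/-- The linear functional on polynomials sending `X ^ ℓ` to `θ_ℓ(m, μ, τ)`. -/
def thetaFunctional {R : Type*} [CommRing R] {k : ℕ} (m : Fin k → ℕ) (μ : Fin k → R) (τ : R) :
    R[X] →ₗ[R] R :=
  ∑ s ∈ Finset.Icc 1 k, τ ^ (s - 1) •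
    ∑ J ∈ Finset.powersetCard s (Finset.univ : Finset (Fin k)),
      (∏ j ∈ J, (m j : R)) • dividedDiff μ J

theorem thetaFunctional_X_pow {R : Type*} [CommRing R] {k : ℕ} (m : Fin k → ℕ) (μ : Fin k → R)
    (τ : R) (ℓ : ℕ) : thetaFunctional m μ τ (X ^ ℓ) = theta m μ τ ℓ := by
  simp only [thetaFunctional, theta, LinearMap.sum_apply, LinearMap.smul_apply, smul_eq_mul]
  refine Finset.sum_congr rfl fun s _ => ?_
  have hJ : ∀ J ∈ Finset.powersetCard s (Finset.univ : Finset (Fin k)),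
      (∏ j ∈ J, (m j : R)) * dividedDiff μ J (X ^ ℓ) =
        (∏ j ∈ J, (m j : R)) * if s ≤ ℓ + 1 then
          ∑ d ∈ J.finsuppAntidiag (ℓ + 1 - s), ∏ j ∈ J, μ j ^ d j else 0 := by
    intro J hJ
    rw [dividedDiff_X_pow, powDividedDiff_eq, (Finset.mem_powersetCard.mp hJ).2]
  rw [Finset.sum_congr rfl hJ]
  split_ifs <;> simp

theorem theta_zero {R : Type*} [CommRing R] {k : ℕ} (hk : 1 ≤ k) (m : Fin k → ℕ) (μ : Fin k → R)
    (τ : R) : theta m μ τ 0 = ((∑ i, m i : ℕ) : R) := by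
  rw [theta, Finset.sum_eq_single_of_mem 1 (Finset.mem_Icc.mpr ⟨le_rfl, hk⟩)]
  · simp [Finset.powersetCard_one]
  · intro s hs hs1
    rw [if_neg]
    have := Finset.mem_Icc.mp hs
    omega

theorem thetaFunctional_shift {R : Type*} [CommRing R] {k : ℕ} (m : Fin k → ℕ) (μ ν : Fin k → R)
    (b : R) (h : ∀ i, ν i = μ i + b) (τ : R) (ℓ : ℕ) :
    thetaFunctional m ν τ ((X - C b) ^ ℓ) = theta m μ τ ℓ := by
  rw [← thetaFunctional_X_pow]
  simp only [thetaFunctional, LinearMap.sum_apply, LinearMap.smul_apply,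
    dividedDiff_shift μ ν b h]

theorem LinearMap.eq_of_eq_on_X_pow {R M : Type*} [CommRing R] [AddCommGroup M] [Module R M]
    {f g : R[X] →ₗ[R] M} {k : ℕ} (h : ∀ r < k, f (X ^ r) = g (X ^ r)) {p : R[X]}
    (hp : p.natDegree < k) : f p = g p := by
  rw [p.as_sum_range' k hp, map_sum, map_sum]
  refine Finset.sum_congr rfl fun r hr => ?_
  rw [← Polynomial.C_mul_X_pow_eq_monomial, ← Polynomial.smul_eq_C_mul, map_smul, map_smul,
    h r (Finset.mem_range.mp hr)]

/-- The algebra map out of `U(g_t)` determined by the images of the generators. -/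
theorem exists_algHom_Ugt {B : Type*} [Ring B] [Algebra Ct B] {n : ℕ} (F : Fin n → Fin n → B)
    (hF : ∀ i j l m, F i j * F m l - F m l * F i j =
      (X : Ct) • ((if j = m then (1 : Ct) else 0) • F i l
        - (if i = l then (1 : Ct) else 0) • F m j)) :
    ∃ ψ : Ugt n →ₐ[Ct] B, ∀ i j, ψ (Egen n i j) = F i j := by
  have hrel : ∀ ⦃x y⦄, glRel n x y →
      FreeAlgebra.lift Ct (fun p : Fin n × Fin n => F p.1 p.2) x =
        FreeAlgebra.lift Ct (fun p : Fin n × Fin n => F p.1 p.2) y := by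
    rintro _ _ ⟨i, j, l, m⟩
    simpa only [map_sub, map_mul, map_smul, FreeAlgebra.lift_ι_apply] using hF i j l m
  refine ⟨RingQuot.liftAlgHom Ct ⟨_, hrel⟩, fun i j => ?_⟩
  rw [Egen, RingQuot.liftAlgHom_mkAlgHom_apply, FreeAlgebra.lift_ι_apply]

theorem map_sub_Ugt {B : Type*} [Ring B] [Algebra Ct B] {n : ℕ} (ψ : Ugt n →ₐ[Ct] B)
    (x y : Ugt n) : ψ (x - y) = ψ x - ψ y :=
  map_sub ψ x y

theorem mapMatrix_op_sub_Ugt {B : Type*} [Ring B] [Algebra Ct B] {n : ℕ} (ψ : Ugt n →ₐ[Ct] B)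
    (M N : Matrix (Fin n) (Fin n) (Ugt n)ᵐᵒᵖ) :
    (AlgHom.op ψ).mapMatrix (M - N) = (AlgHom.op ψ).mapMatrix M - (AlgHom.op ψ).mapMatrix N :=
  map_sub (AlgHom.op ψ).mapMatrix M N

theorem Egen_commutator (n : ℕ) (i j l m : Fin n) :
    Egen n i j * Egen n m l - Egen n m l * Egen n i j =
      (X : Ct) • ((if j = m then (1 : Ct) else 0) • Egen n i l
        - (if i = l then (1 : Ct) else 0) • Egen n m j) := by
  have := RingQuot.mkAlgHom_rel Ct (glRel.comm i j l m)
  simp only [map_sub, map_mul, map_smul] at this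
  exact this

theorem mapMatrix_prodE {B : Type*} [Ring B] [Algebra Ct B] {n k : ℕ} (ψ : Ugt n →ₐ[Ct] B)
    (μ : Fin k → Ct) (i j : Fin n) :
    ψ (prodE n k μ i j) = unop ((List.ofFn fun s : Fin k =>
      (AlgHom.op ψ).mapMatrix (EmatOp n) -
        algebraMap Ct (Matrix (Fin n) (Fin n) Bᵐᵒᵖ) (μ s)).prod i j) := by
  have h : (AlgHom.op ψ).mapMatrix (List.ofFn fun s : Fin k =>
      EmatOp n - algebraMap Ct (Matrix (Fin n) (Fin n) (Ugt n)ᵐᵒᵖ) (μ s)).prod =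
      (List.ofFn fun s : Fin k => (AlgHom.op ψ).mapMatrix (EmatOp n) -
        algebraMap Ct (Matrix (Fin n) (Fin n) Bᵐᵒᵖ) (μ s)).prod := by
    rw [map_list_prod, List.map_ofFn]
    simp only [Function.comp_def, mapMatrix_op_sub_Ugt, AlgHom.commutes]
  rw [← h]
  rfl

theorem mapMatrix_trE {B : Type*} [Ring B] [Algebra Ct B] {n : ℕ} (ψ : Ugt n →ₐ[Ct] B) (ℓ : ℕ) :
    ψ (trE n ℓ) = unop (Matrix.trace ((AlgHom.op ψ).mapMatrix (EmatOp n) ^ ℓ)) := by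
  rw [← map_pow, AlgHom.mapMatrix_apply, ← AddMonoidHom.map_trace (AlgHom.op ψ)]
  rfl

/-- The functional `p ↦ Tr p(M)` for a matrix over an opposite algebra. -/
def opTraceFunctional {B : Type*} [Ring B] [Algebra Ct B] {n : ℕ}
    (M : Matrix (Fin n) (Fin n) Bᵐᵒᵖ) : Ct[X] →ₗ[Ct] B :=
  (opLinearEquiv Ct).symm.toLinearMap ∘ₗ Matrix.traceLinearMap (Fin n) Ct Bᵐᵒᵖ ∘ₗ
    (aeval M).toLinearMap

theorem opTraceFunctional_apply {B : Type*} [Ring B] [Algebra Ct B] {n : ℕ}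
    (M : Matrix (Fin n) (Fin n) Bᵐᵒᵖ) (p : Ct[X]) :
    opTraceFunctional M p = unop (Matrix.trace (aeval M p)) := rfl

theorem clsA_eq_zero {n k : ℕ} {m : Fin k → ℕ} {μ : Fin k → Ct} {u : Ugt n}
    (hu : u ∈ genSetA n k m μ) :
    RingQuot.mkAlgHom Ct (fun a b : Ugt n => a - b ∈ genSetA n k m μ) u = 0 := by
  have : u - 0 ∈ genSetA n k m μ := (sub_zero u).symm ▸ hu
  rw [RingQuot.mkAlgHom_rel Ct (s := fun a b : Ugt n => a - b ∈ genSetA n k m μ) this, map_zero]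

theorem exists_shift_algHom {n k : ℕ} (hk : 1 ≤ k) (m : Fin k → ℕ) (hsum : ∑ i, m i = n)
    (μ ν : Fin k → Ct) (b : Ct) (h : ∀ i, ν i = μ i + b) :
    ∃ φ : AlgA n k m μ →ₐ[Ct] AlgA n k m ν,
      ∀ i j : Fin n, φ (clsA n k m μ (Egen n i j)) =
        clsA n k m ν (Egen n i j) - algebraMap Ct (AlgA n k m ν) (if i = j then b else 0) := by
  set q : Ugt n →ₐ[Ct] AlgA n k m ν := RingQuot.mkAlgHom Ct _
  obtain ⟨ψ, hψ⟩ := exists_algHom_Ugt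
    (fun i j => q (Egen n i j) - algebraMap Ct (AlgA n k m ν) (if i = j then b else 0)) (by
      intro i j l m'
      have hc : ∀ (x y : AlgA n k m ν) (c d : Ct),
          (x - algebraMap Ct _ c) * (y - algebraMap Ct _ d) -
            (y - algebraMap Ct _ d) * (x - algebraMap Ct _ c) = x * y - y * x := by
        intro x y c d
        have h1 := Algebra.commutes c y
        have h2 := Algebra.commutes d x
        have h3 := Algebra.commutes c (algebraMap Ct (AlgA n k m ν) d)
        simp only [sub_mul, mul_sub, h1, h2, h3]
        abel
      rw [hc, ← map_mul, ← map_mul, ← map_sub_Ugt, Egen_commutator, map_smul, map_sub_Ugt, map_smul,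
        map_smul]
      congr 1
      by_cases h1 : j = m' <;> by_cases h2 : i = l <;> simp [h1, h2, eq_comm])
  have hM : (AlgHom.op ψ).mapMatrix (EmatOp n) = (AlgHom.op q).mapMatrix (EmatOp n) -
      algebraMap Ct (Matrix (Fin n) (Fin n) (AlgA n k m ν)ᵐᵒᵖ) b := by
    ext i j
    apply unop_injective
    refine (hψ i j).trans ?_
    rw [Matrix.sub_apply, unop_sub, Matrix.algebraMap_matrix_apply]
    split_ifs
    · rfl
    · rw [map_zero]
      rfl
  have htr : ∀ r < k, opTraceFunctional ((AlgHom.op q).mapMatrix (EmatOp n)) (X ^ r) =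
      ((Algebra.linearMap Ct (AlgA n k m ν)) ∘ₗ thetaFunctional m ν X) (X ^ r) := by
    intro r hr
    rw [LinearMap.comp_apply, thetaFunctional_X_pow, opTraceFunctional_apply, map_pow, aeval_X,
      Algebra.linearMap_apply]
    rcases Nat.eq_zero_or_pos r with rfl | hr0
    · rw [theta_zero hk, hsum, pow_zero, Matrix.trace_one, Fintype.card_fin, map_natCast,
        unop_natCast]
    · rw [← mapMatrix_trE, ← sub_eq_zero, ← AlgHom.commutes q, ← map_sub]
      exact clsA_eq_zero (Or.inr ⟨r, Finset.mem_Icc.mpr ⟨hr0, by omega⟩, rfl⟩)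
  have hzero : ∀ u ∈ genSetA n k m μ, ψ u = 0 := by
    rintro _ (⟨i, j, rfl⟩ | ⟨ℓ, hℓ, rfl⟩)
    · have hs : ∀ s, (AlgHom.op ψ).mapMatrix (EmatOp n) -
          algebraMap Ct (Matrix (Fin n) (Fin n) (AlgA n k m ν)ᵐᵒᵖ) (μ s) =
          (AlgHom.op q).mapMatrix (EmatOp n) -
            algebraMap Ct (Matrix (Fin n) (Fin n) (AlgA n k m ν)ᵐᵒᵖ) (ν s) := by
        intro s
        rw [hM, h s, map_add, sub_sub, add_comm]
      simp only [mapMatrix_prodE, hs]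
      rw [← mapMatrix_prodE]
      exact clsA_eq_zero (Or.inl ⟨i, j, rfl⟩)
    · have hℓk : ((X - C b : Ct[X]) ^ ℓ).natDegree < k := by
        rw [natDegree_pow, natDegree_X_sub_C]
        have := Finset.mem_Icc.mp hℓ
        omega
      have := LinearMap.eq_of_eq_on_X_pow htr hℓk
      rw [LinearMap.comp_apply, thetaFunctional_shift m μ ν b h, opTraceFunctional_apply, map_pow,
        map_sub, aeval_X, aeval_C, ← hM, ← mapMatrix_trE, Algebra.linearMap_apply] at this
      rw [map_sub_Ugt, AlgHom.commutes, this, sub_self]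
  have hrel : ∀ ⦃x y : Ugt n⦄, x - y ∈ genSetA n k m μ → ψ x = ψ y := fun x y hxy =>
    sub_eq_zero.mp ((map_sub ψ x y).symm.trans (hzero _ hxy))
  refine ⟨RingQuot.liftAlgHom Ct ⟨ψ, hrel⟩, fun i j => ?_⟩
  rw [clsA, RingQuot.liftAlgHom_mkAlgHom_apply]
  exact hψ i j

theorem AlgA_hom_ext {B : Type*} [Ring B] [Algebra Ct B] {n k : ℕ} {m : Fin k → ℕ}
    {μ : Fin k → Ct} {f g : AlgA n k m μ →ₐ[Ct] B}
    (h : ∀ i j, f (clsA n k m μ (Egen n i j)) = g (clsA n k m μ (Egen n i j))) : f = g := by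
  apply RingQuot.ringQuot_ext'
  apply RingQuot.ringQuot_ext'
  apply FreeAlgebra.hom_ext
  funext p
  exact h p.1 p.2

/-- `E^i_j ↦ E^i_j − b·δ^i_j·1` extends to a `ℂ[t]`-algebra isomorphism
`A_{m,μ,t} → A_{m,μ+b·(1,…,1),t}`. -/
theorem statement18 (n k : ℕ) (hn : 1 ≤ n) (hk : 1 ≤ k) (hkn : k ≤ n)
    (m : Fin k → ℕ) (hm : ∀ i, 0 < m i) (hsum : ∑ i, m i = n)
    (μ : Fin k → ℂ) (b : ℂ) :
    ∃ φ : AlgA n k m (fun i => C (μ i)) ≃ₐ[Ct] AlgA n k m (fun i => C (μ i + b)),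
      ∀ i j : Fin n,
        φ (clsA n k m (fun i => C (μ i)) (Egen n i j)) =
          clsA n k m (fun i => C (μ i + b)) (Egen n i j)
            - algebraMap Ct (AlgA n k m (fun i => C (μ i + b)))
                (if i = j then C b else 0) := by
  obtain ⟨φ, hφ⟩ := exists_shift_algHom hk m hsum (fun i => C (μ i)) (fun i => C (μ i + b)) (C b)
    fun i => C_add
  obtain ⟨χ, hχ⟩ := exists_shift_algHom hk m hsum (fun i => C (μ i + b)) (fun i => C (μ i))
    (-C b) fun i => by rw [C_add, add_neg_cancel_right]
  refine ⟨AlgEquiv.ofAlgHom φ χ (AlgA_hom_ext fun i j => ?_) (AlgA_hom_ext fun i j => ?_), hφ⟩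
  · rw [AlgHom.comp_apply, hχ, map_sub, AlgHom.commutes, hφ, AlgHom.id_apply]
    split_ifs <;> simp
  · rw [AlgHom.comp_apply, hφ, map_sub, AlgHom.commutes, hχ, AlgHom.id_apply]
    split_ifs <;> simp

end
end
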